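/- Let p be a prime, G a group and H a subgroup of G, and let K denote the image in G of (N_p)_ω(H) under the inclusion H ↪ G. Assume K is a normal subgroup of G. Then the quotient groups G/(N_p)_ω(G) and (G/K)/(N_p)_ω(G/K) are isomorphic. -/

import Mathlib

/-- `(N_p)_ω(G)`: the intersection of all normal subgroups of `G` whose index is finite and
equal to a power of the prime `p`. -/
def NpOmega (p : ℕ) (G : Type*) [Group G] : Subgroup G :=
  ⨅ N ∈ {N : Subgroup G | N.Normal ∧ ∃ n : ℕ, N.index = p ^ n}, N

instance NpOmega.normal (p : ℕ) (G : Type*) [Group G] : (NpOmega p G).Normal := by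
  constructor
  intro x hx g
  simp only [NpOmega, Subgroup.mem_iInf] at hx ⊢
  intro N hN
  exact hN.1.conj_mem x (hx N hN) g

theorem mem_NpOmega {p : ℕ} {G : Type*} [Group G] {x : G} :
    x ∈ NpOmega p G ↔ ∀ N : Subgroup G, N.Normal → (∃ n : ℕ, N.index = p ^ n) → x ∈ N := by
  simp only [NpOmega, Subgroup.mem_iInf, Set.mem_ofPred_eq, and_imp]

/-- A group homomorphism `f : H →* G` maps `(N_p)_ω(H)` into `(N_p)_ω(G)`. -/
theorem NpOmega_map_le {p : ℕ} (hp : p.Prime) {G H : Type*} [Group G] [Group H] (f : H →* G) :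
    (NpOmega p H).map f ≤ NpOmega p G := by
  rintro _ ⟨x, hx, rfl⟩
  refine mem_NpOmega.2 fun N hN ⟨n, hn⟩ => ?_
  refine mem_NpOmega.1 hx (N.comap f) (hN.comap f) ?_
  have hdvd : (N.comap f).index ∣ p ^ n := by
    rw [Subgroup.index_comap, ← hn]
    exact Subgroup.relIndex_dvd_index_of_normal N f.range
  obtain ⟨k, -, hk⟩ := (Nat.dvd_prime_pow hp).1 hdvd
  exact ⟨k, hk⟩

/-- A surjective homomorphism whose kernel lies in `(N_p)_ω(G)` maps `(N_p)_ω(G)` onto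
`(N_p)_ω(Q)`. -/
theorem NpOmega_map_eq {p : ℕ} (hp : p.Prime) {G Q : Type*} [Group G] [Group Q] (f : G →* Q)
    (hf : Function.Surjective f) (hker : f.ker ≤ NpOmega p G) :
    (NpOmega p G).map f = NpOmega p Q := by
  refine le_antisymm (NpOmega_map_le hp f) fun y hy => ?_
  obtain ⟨x, rfl⟩ := hf y
  refine Subgroup.mem_map_of_mem f (mem_NpOmega.2 fun N hN ⟨n, hn⟩ => ?_)
  have hkerN : f.ker ≤ N := fun z hz => mem_NpOmega.1 (hker hz) N hN ⟨n, hn⟩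
  have hx : f x ∈ N.map f :=
    mem_NpOmega.1 hy (N.map f) (hN.map f hf) ⟨n, (N.index_map_eq hf hkerN).trans hn⟩
  rwa [← Subgroup.mem_comap, Subgroup.comap_map_eq_self hkerN] at hx

/-- Let `p` be a prime, `G` a group, `H ≤ G` and `K` the image in `G` of `(N_p)_ω(H)` under
the inclusion `H ↪ G`. If `K` is normal in `G`, then `G/(N_p)_ω(G)` and
`(G/K)/(N_p)_ω(G/K)` are isomorphic. -/
theorem quotient_NpOmega_iso (p : ℕ) (hp : p.Prime) (G : Type*) [Group G] (H : Subgroup G)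
    [hK : ((NpOmega p H).map H.subtype).Normal] :
    Nonempty ((G ⧸ NpOmega p G) ≃*
      ((G ⧸ (NpOmega p H).map H.subtype) ⧸
        NpOmega p (G ⧸ (NpOmega p H).map H.subtype))) := by
  have hle := NpOmega_map_le hp H.subtype
  have hmap := NpOmega_map_eq hp (QuotientGroup.mk' ((NpOmega p H).map H.subtype))
    (QuotientGroup.mk'_surjective _) (by rwa [QuotientGroup.ker_mk'])
  exact ⟨(QuotientGroup.quotientQuotientEquivQuotient _ _ hle).symm.trans
    (QuotientGroup.quotientMulEquivOfEq hmap)⟩
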